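/- arXiv:1709.01067 — 6 statements merged into one kernel-verified Lean document; each statement's English description precedes it below -/
import Mathlib

section
/- Let α > 0, β > 0 and a < 0 < b be real numbers and let p ∈ ℝ. Then the function z ↦ (α/2)z² − p·z + β|z| attains its minimum over the interval [a, b] exactly at the point z* = max(a, min(soft(p, β)/α, b)); that is, z* lies in [a, b], it minimizes the function over [a, b], and it is the unique minimizer. -/
/-- Variational inequality for the projection onto `[a, b]`. -/
theorem sub_clamp_mul_sub_clamp_nonpos {a b z : ℝ} (v : ℝ) (hz : z ∈ Set.Icc a b) :
    (v - max a (min v b)) * (z - max a (min v b)) ≤ 0 := by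
  obtain ⟨haz, hzb⟩ := hz
  rcases le_total v a with hva | hva
  · rw [min_eq_left (by linarith), max_eq_left hva]
    exact mul_nonpos_of_nonpos_of_nonneg (by linarith) (by linarith)
  rcases le_total v b with hvb | hvb
  · rw [min_eq_left hvb, max_eq_right hva]
    simp
  · rw [min_eq_right hvb, max_eq_right (by linarith)]
    exact mul_nonpos_of_nonneg_of_nonpos (by linarith) (by linarith)

/-- The residual of soft-thresholding is a subgradient of `β * |·|` at every point having the sign
of the thresholded value, in particular at its scaled projection onto an interval around `0`. -/
theorem soft_residual_mul_clamp {α β a b : ℝ} (p : ℝ) (hα : 0 < α) (hβ : 0 < β) (ha : a < 0)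
    (hb : 0 < b) :
    |p - Real.sign p * max (|p| - β) 0| ≤ β ∧
      (p - Real.sign p * max (|p| - β) 0) *
          max a (min (Real.sign p * max (|p| - β) 0 / α) b) =
        β * |max a (min (Real.sign p * max (|p| - β) 0 / α) b)| := by
  rcases lt_or_ge β |p| with h | h
  · rw [max_eq_left (by linarith : (0 : ℝ) ≤ |p| - β)]
    rcases lt_abs.mp h with hp | hp
    · rw [Real.sign_of_pos (by linarith), abs_of_pos (by linarith : 0 < p), one_mul,
        sub_sub_cancel, abs_of_pos hβ]
      have hs : 0 < (p - β) / α := div_pos (by linarith) hα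
      rw [abs_of_nonneg (le_max_of_le_right (le_min hs.le hb.le))]
      exact ⟨le_rfl, rfl⟩
    · rw [Real.sign_of_neg (by linarith), abs_of_neg (by linarith : p < 0),
        show p - -1 * (-p - β) = -β by ring, abs_neg, abs_of_pos hβ]
      have hs : -1 * (-p - β) / α < 0 := div_neg_of_neg_of_pos (by linarith) hα
      rw [abs_of_nonpos (max_le ha.le (min_le_of_left_le hs.le))]
      exact ⟨le_rfl, by ring⟩
  · rw [max_eq_right (by linarith : |p| - β ≤ 0)]
    simp [h, ha.le, hb.le]

/-- Quadratic growth of the objective around the projected soft-thresholding point. -/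
theorem quadratic_growth_clamp_soft {α β a b z : ℝ} (p : ℝ) (hα : 0 < α) (hβ : 0 < β)
    (ha : a < 0) (hb : 0 < b) (hz : z ∈ Set.Icc a b) :
    α / 2 * (z - max a (min (Real.sign p * max (|p| - β) 0 / α) b)) ^ 2 ≤
      (α / 2 * z ^ 2 - p * z + β * |z|) -
        (α / 2 * max a (min (Real.sign p * max (|p| - β) 0 / α) b) ^ 2 -
          p * max a (min (Real.sign p * max (|p| - β) 0 / α) b) +
          β * |max a (min (Real.sign p * max (|p| - β) 0 / α) b)|) := by
  obtain ⟨hq, hqw⟩ := soft_residual_mul_clamp p hα hβ ha hb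
  have hproj := sub_clamp_mul_sub_clamp_nonpos (Real.sign p * max (|p| - β) 0 / α) hz
  generalize max a (min (Real.sign p * max (|p| - β) 0 / α) b) = w at *
  generalize Real.sign p * max (|p| - β) 0 = s at *
  have hqz : (p - s) * z ≤ β * |z| :=
    (le_abs_self _).trans (abs_mul (p - s) z ▸ mul_le_mul_of_nonneg_right hq (abs_nonneg z))
  have hscaled : (s - α * w) * (z - w) ≤ 0 := by
    have h := mul_nonpos_of_nonneg_of_nonpos hα.le hproj
    rwa [← mul_assoc, mul_sub α, mul_div_cancel₀ _ hα.ne'] at h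
  linarith


/-- for `α, β > 0`, `a < 0 < b` and `p ∈ ℝ`, the function
`z ↦ (α/2)z² − p·z + β|z|` attains its minimum over `[a, b]` exactly at
`z* = Π_{[a,b]}(soft(p, β)/α) = max(a, min(soft(p, β)/α, b))`, where
`soft(p, β) = sgn(p)·max(|p| − β, 0)`: `z*` lies in `[a,b]`, it is a minimizer
over `[a,b]`, and it is the unique minimizer over `[a,b]`. -/
theorem stmt_1 (α β a b p : ℝ) (hα : 0 < α) (hβ : 0 < β) (ha : a < 0) (hb : 0 < b) :
    max a (min (Real.sign p * max (|p| - β) 0 / α) b) ∈ Set.Icc a b ∧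
    IsMinOn (fun z : ℝ => α / 2 * z ^ 2 - p * z + β * |z|) (Set.Icc a b)
      (max a (min (Real.sign p * max (|p| - β) 0 / α) b)) ∧
    ∀ z ∈ Set.Icc a b,
      IsMinOn (fun z : ℝ => α / 2 * z ^ 2 - p * z + β * |z|) (Set.Icc a b) z →
        z = max a (min (Real.sign p * max (|p| - β) 0 / α) b) := by
  refine ⟨⟨le_max_left _ _, max_le (by linarith) (min_le_right _ _)⟩, fun z hz => ?_,
    fun z hz hmin => ?_⟩
  · have h := quadratic_growth_clamp_soft p hα hβ ha hb hz
    have hsq := mul_nonneg (half_pos hα).le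
      (sq_nonneg (z - max a (min (Real.sign p * max (|p| - β) 0 / α) b)))
    exact sub_nonneg.mp (hsq.trans h)
  · have h := quadratic_growth_clamp_soft p hα hβ ha hb hz
    have hle := isMinOn_iff.mp hmin (max a (min (Real.sign p * max (|p| - β) 0 / α) b))
      ⟨le_max_left _ _, max_le (by linarith) (min_le_right _ _)⟩
    have hsq := nonpos_of_mul_nonpos_right (h.trans (sub_nonpos.mpr hle)) (half_pos hα)
    exact sub_eq_zero.mp (pow_eq_zero_iff two_ne_zero |>.mp (le_antisymm hsq (sq_nonneg _)))
end

section
/- Let α > 0, β > 0, σ > 0, a < 0 < b, let n ≥ 1, let W be a diagonal real n×n matrix with positive diagonal entries w_1, …, w_n, and let u, λ ∈ ℝⁿ. Then the function z ↦ (α/4)zᵀWz + β Σ_{i=1}^n w_i|z_i| + ⟨λ, u − z⟩ + (σ/2)‖u − z‖² attains its minimum over the box [a, b]ⁿ at the unique point z* given componentwise by z*_i = Π_{[a,b]}( w_i · soft((σ u_i + λ_i)/w_i, β) / ((α/2)w_i + σ) ). -/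
open Matrix

theorem soft_threshold_cases {β : ℝ} (hβ : 0 < β) (t : ℝ) :
    (0 < t - β ∧ Real.sign t * max (|t| - β) 0 = t - β) ∨
    (t + β < 0 ∧ Real.sign t * max (|t| - β) 0 = t + β) ∨
    (|t| ≤ β ∧ Real.sign t * max (|t| - β) 0 = 0) := by
  rcases le_or_gt |t| β with h | h
  · exact Or.inr (Or.inr ⟨h, by rw [max_eq_right (by linarith), mul_zero]⟩)
  · rcases lt_abs.1 h with h' | h'
    · refine Or.inl ⟨by linarith, ?_⟩
      rw [Real.sign_of_pos (by linarith), abs_of_pos (by linarith), max_eq_left (by linarith)]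
      ring
    · refine Or.inr (Or.inl ⟨by linarith, ?_⟩)
      rw [Real.sign_of_neg (by linarith), abs_of_neg (by linarith), max_eq_left (by linarith)]
      ring

/-- Variational inequality for the projection onto an interval. -/
theorem clamp_variational {a b m z : ℝ} (hz : z ∈ Set.Icc a b) :
    0 ≤ (max a (min m b) - m) * (z - max a (min m b)) := by
  obtain ⟨h₁, h₂⟩ := hz
  rcases le_total m b with h | h
  · rw [min_eq_left h]
    rcases le_total a m with h' | h'
    · simp [max_eq_right h']
    · rw [max_eq_left h']
      exact mul_nonneg (by linarith) (by linarith)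
  · rw [min_eq_right h, max_eq_right (h₁.trans h₂)]
    exact mul_nonneg_of_nonpos_of_nonpos (by linarith) (by linarith)

/-- The residual of soft-thresholding is a subgradient of `β|·|` at the projection of a positive
multiple of the thresholded value. -/
theorem soft_threshold_subgradient {a b β r : ℝ} (hβ : 0 < β) (ha : a < 0) (hb : 0 < b)
    (hr : 0 < r) (t z : ℝ) :
    (t - Real.sign t * max (|t| - β) 0) *
        (z - max a (min (r * (Real.sign t * max (|t| - β) 0)) b)) ≤
      β * (|z| - |max a (min (r * (Real.sign t * max (|t| - β) 0)) b)|) := by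
  rcases soft_threshold_cases hβ t with ⟨h, hs⟩ | ⟨h, hs⟩ | ⟨h, hs⟩ <;> rw [hs]
  · have hp : 0 ≤ max a (min (r * (t - β)) b) :=
      le_max_of_le_right (le_min (mul_pos hr h).le hb.le)
    rw [abs_of_nonneg hp, sub_sub_cancel]
    exact mul_le_mul_of_nonneg_left (by linarith [le_abs_self z]) hβ.le
  · have hp : max a (min (r * (t + β)) b) ≤ 0 :=
      max_le ha.le (min_le_of_left_le (mul_neg_of_pos_of_neg hr h).le)
    rw [abs_of_nonpos hp]
    nlinarith [mul_le_mul_of_nonneg_left (neg_abs_le z) hβ.le]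
  · rw [mul_zero, min_eq_left hb.le, max_eq_right ha.le, abs_zero, sub_zero, sub_zero, sub_zero]
    calc t * z ≤ |t * z| := le_abs_self _
      _ = |t| * |z| := abs_mul t z
      _ ≤ β * |z| := mul_le_mul_of_nonneg_right h (abs_nonneg z)

/-- Quadratic growth of the scalar objective around its constrained minimizer. -/
theorem box_prox_quadratic_growth {α β σ a b w : ℝ} (hα : 0 < α) (hβ : 0 < β) (hσ : 0 < σ)
    (ha : a < 0) (hb : 0 < b) (hw : 0 < w) (u l p z : ℝ)
    (hp : p = max a (min (w * (Real.sign ((σ * u + l) / w) *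
      max (|(σ * u + l) / w| - β) 0) / (α / 2 * w + σ)) b))
    (hz : z ∈ Set.Icc a b) :
    α / 4 * (w * p ^ 2) + β * (w * |p|) + l * (u - p) + σ / 2 * ((u - p) * (u - p)) +
        σ / 2 * (z - p) ^ 2 ≤
      α / 4 * (w * z ^ 2) + β * (w * |z|) + l * (u - z) + σ / 2 * ((u - z) * (u - z)) := by
  have hk : 0 < α / 2 * w + σ := by positivity
  obtain ⟨t, ht⟩ : ∃ t, t = (σ * u + l) / w := ⟨_, rfl⟩
  have hl : l = w * t - σ * u := by rw [ht]; field_simp; ring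
  rw [← ht] at hp
  have hsub := soft_threshold_subgradient hβ ha hb (div_pos hw hk) t z
  rw [div_mul_eq_mul_div, ← hp] at hsub
  have hvar := clamp_variational
    (m := w * (Real.sign t * max (|t| - β) 0) / (α / 2 * w + σ)) hz
  rw [← hp] at hvar
  generalize Real.sign t * max (|t| - β) 0 = s at hsub hvar
  have hvar' : 0 ≤ ((α / 2 * w + σ) * p - w * s) * (z - p) := by
    have h := mul_nonneg hk.le hvar
    have e : (α / 2 * w + σ) * (w * s / (α / 2 * w + σ)) = w * s := mul_div_cancel₀ _ hk.ne'
    rwa [← mul_assoc, mul_sub (α / 2 * w + σ) p, e] at h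
  have hsub' := mul_le_mul_of_nonneg_left hsub hw.le
  have hsq : 0 ≤ α / 4 * w * (z - p) ^ 2 := by positivity
  subst hl
  linarith

/-- for `α, β, σ > 0`, `a < 0 < b`, a diagonal weight matrix `W = diag(w)` with
positive entries, and `u, λ ∈ ℝⁿ`, the function
`z ↦ (α/4)zᵀWz + β Σᵢ wᵢ|zᵢ| + ⟨λ, u − z⟩ + (σ/2)‖u − z‖²`
attains its minimum over the box `[a,b]ⁿ` at the unique point `z*` given componentwise by
`z*ᵢ = Π_{[a,b]}( wᵢ · soft((σuᵢ + λᵢ)/wᵢ, β) / ((α/2)wᵢ + σ) )`. -/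
theorem stmt_2 (n : ℕ) (hn : 1 ≤ n) (α β σ a b : ℝ)
    (hα : 0 < α) (hβ : 0 < β) (hσ : 0 < σ) (ha : a < 0) (hb : 0 < b)
    (w : Fin n → ℝ) (hw : ∀ i, 0 < w i) (u lam : Fin n → ℝ) :
    ∀ zstar : Fin n → ℝ,
      (∀ i, zstar i =
        max a (min (w i * (Real.sign ((σ * u i + lam i) / w i) *
            max (|(σ * u i + lam i) / w i| - β) 0) / (α / 2 * w i + σ)) b)) →
      (∀ i, zstar i ∈ Set.Icc a b) ∧
      IsMinOn (fun z : Fin n → ℝ =>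
          α / 4 * ∑ i, w i * z i ^ 2 + β * ∑ i, w i * |z i|
            + lam ⬝ᵥ (u - z) + σ / 2 * ((u - z) ⬝ᵥ (u - z)))
        {z : Fin n → ℝ | ∀ i, z i ∈ Set.Icc a b} zstar ∧
      ∀ z ∈ {z : Fin n → ℝ | ∀ i, z i ∈ Set.Icc a b},
        IsMinOn (fun z : Fin n → ℝ =>
            α / 4 * ∑ i, w i * z i ^ 2 + β * ∑ i, w i * |z i|
              + lam ⬝ᵥ (u - z) + σ / 2 * ((u - z) ⬝ᵥ (u - z)))
          {z : Fin n → ℝ | ∀ i, z i ∈ Set.Icc a b} z →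
          z = zstar := by
  intro p hp
  have hbox : ∀ i, p i ∈ Set.Icc a b := fun i => by
    rw [hp i]
    exact ⟨le_max_left _ _, max_le (ha.trans hb).le (min_le_right _ _)⟩
  have growth : ∀ z : Fin n → ℝ, (∀ i, z i ∈ Set.Icc a b) →
      α / 4 * ∑ i, w i * p i ^ 2 + β * ∑ i, w i * |p i|
          + lam ⬝ᵥ (u - p) + σ / 2 * ((u - p) ⬝ᵥ (u - p)) + ∑ i, σ / 2 * (z i - p i) ^ 2 ≤
        α / 4 * ∑ i, w i * z i ^ 2 + β * ∑ i, w i * |z i|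
          + lam ⬝ᵥ (u - z) + σ / 2 * ((u - z) ⬝ᵥ (u - z)) := fun z hz => by
    simp only [dotProduct, Pi.sub_apply, Finset.mul_sum, ← Finset.sum_add_distrib]
    exact Finset.sum_le_sum fun i _ =>
      box_prox_quadratic_growth hα hβ hσ ha hb (hw i) (u i) (lam i) (p i) (z i) (hp i) (hz i)
  have hnonneg : ∀ z : Fin n → ℝ, ∀ i ∈ Finset.univ, 0 ≤ σ / 2 * (z i - p i) ^ 2 :=
    fun z i _ => by positivity
  refine ⟨hbox, fun z hz => ?_, fun z hz hmin => ?_⟩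
  · exact (le_add_of_nonneg_right (Finset.sum_nonneg (hnonneg z))).trans (growth z hz)
  · have hle := isMinOn_iff.1 hmin p hbox
    have hsum : ∑ i, σ / 2 * (z i - p i) ^ 2 = 0 :=
      le_antisymm (by linarith [growth z hz]) (Finset.sum_nonneg (hnonneg z))
    funext i
    have h := (Finset.sum_eq_zero_iff_of_nonneg (hnonneg z)).1 hsum i (Finset.mem_univ i)
    have h' := (mul_eq_zero.1 h).resolve_left (by positivity)
    exact sub_eq_zero.1 (pow_eq_zero_iff two_ne_zero |>.1 h')
end

section
/- Let α > 0, β > 0, σ > 0, a < 0 < b, let n ≥ 1, let M be a symmetric positive definite real n×n matrix, let W be a diagonal real n×n matrix with positive diagonal entries w_1, …, w_n, and let u, λ ∈ ℝⁿ. Then the function z ↦ (α/4)zᵀWz + β Σ_{i=1}^n w_i|z_i| + ⟨λ, M(u − z)⟩ + (σ/2)(u − z)ᵀW(u − z) attains its minimum over the box [a, b]ⁿ at the unique point z* given componentwise by z*_i = Π_{[a,b]}( soft(σ u_i + (Mλ)_i/w_i, β) / (σ + α/2) ). -/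
open Matrix

/-- The residual `v - soft(v, β)` is a subgradient of `β|·|` at `soft(v, β)`. -/
lemma soft_residual_subgradient {β : ℝ} (hβ : 0 < β) (v : ℝ) :
    |v - Real.sign v * max (|v| - β) 0| ≤ β ∧
      (0 < Real.sign v * max (|v| - β) 0 → v - Real.sign v * max (|v| - β) 0 = β) ∧
      (Real.sign v * max (|v| - β) 0 < 0 → v - Real.sign v * max (|v| - β) 0 = -β) := by
  rcases lt_trichotomy v 0 with h | rfl | h
  · rw [Real.sign_of_neg h, abs_of_neg h, abs_le]
    rcases max_cases (-v - β) 0 with ⟨e, h'⟩ | ⟨e, h'⟩ <;> rw [e] <;>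
      refine ⟨⟨?_, ?_⟩, fun _ => ?_, fun _ => ?_⟩ <;> linarith
  · simp [hβ.le]
  · rw [Real.sign_of_pos h, abs_of_pos h, abs_le]
    rcases max_cases (v - β) 0 with ⟨e, h'⟩ | ⟨e, h'⟩ <;> rw [e] <;>
      refine ⟨⟨?_, ?_⟩, fun _ => ?_, fun _ => ?_⟩ <;> linarith

/-- The variational inequality for the projection onto an interval. -/
lemma proj_Icc_variational {a b q t : ℝ} (hab : a ≤ b) (ht : t ∈ Set.Icc a b) :
    0 ≤ (max a (min q b) - q) * (t - max a (min q b)) := by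
  obtain ⟨h₁, h₂⟩ := ht
  rcases le_total q b with hq | hq
  · rw [min_eq_left hq]
    rcases le_total a q with hq' | hq'
    · simp [max_eq_right hq']
    · rw [max_eq_left hq']
      exact mul_nonneg (by linarith) (by linarith)
  · rw [min_eq_right hq, max_eq_right hab]
    exact mul_nonneg_of_nonpos_of_nonpos (by linarith) (by linarith)

/-- Quadratic growth of `t ↦ (c/2)t² + β|t| - vt` on `[a, b]` around its minimizer, the projection
of the soft-thresholded point. -/
lemma soft_proj_quadratic_growth {a b c β : ℝ} (ha : a < 0) (hb : 0 < b) (hc : 0 < c) (hβ : 0 < β)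
    (v : ℝ) {p t : ℝ} (hp : p = max a (min (Real.sign v * max (|v| - β) 0 / c) b))
    (ht : t ∈ Set.Icc a b) :
    c / 2 * (t - p) ^ 2 ≤
      (c / 2 * t ^ 2 + β * |t| - v * t) - (c / 2 * p ^ 2 + β * |p| - v * p) := by
  obtain ⟨hg, hpos, hneg⟩ := soft_residual_subgradient hβ v
  set s := Real.sign v * max (|v| - β) 0
  have hvar := mul_nonneg hc.le (proj_Icc_variational (q := s / c) (ha.trans hb).le ht)
  rw [← hp] at hvar
  have hs : c * (s / c) = s := mul_div_cancel₀ s hc.ne'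
  have hgp : (v - s) * p = β * |p| := by
    rcases lt_trichotomy p 0 with h | rfl | h
    · have hq : s / c < 0 := by
        by_contra! hq
        have : 0 ≤ p := hp ▸ le_max_of_le_right (le_min hq hb.le)
        linarith
      rw [hneg (by rw [← hs]; exact mul_neg_of_pos_of_neg hc hq), abs_of_neg h]
      ring
    · simp
    · have hq : 0 < s / c := by
        by_contra! hq
        have : p ≤ 0 := hp ▸ max_le ha.le (min_le_of_left_le hq)
        linarith
      rw [hpos (by rw [← hs]; exact mul_pos hc hq), abs_of_pos h]
  have hgt : (v - s) * t ≤ β * |t| :=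
    (le_abs_self _).trans (by rw [abs_mul]; gcongr)
  have hvar' : 0 ≤ (c * p - s) * (t - p) := by
    calc 0 ≤ c * ((p - s / c) * (t - p)) := hvar
      _ = (c * p - c * (s / c)) * (t - p) := by ring
      _ = _ := by rw [hs]
  linarith

/-- The objective is a constant plus a weighted sum of scalar functions. -/
lemma objective_separable {n : ℕ} (α β σ : ℝ) {M : Matrix (Fin n) (Fin n) ℝ} (hM : M.IsSymm)
    {w : Fin n → ℝ} (hw : ∀ i, w i ≠ 0) (u lam z : Fin n → ℝ) :
    α / 4 * ∑ i, w i * z i ^ 2 + β * ∑ i, w i * |z i|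
        + lam ⬝ᵥ (M *ᵥ (u - z)) + σ / 2 * ∑ i, w i * (u i - z i) ^ 2 =
      (lam ⬝ᵥ (M *ᵥ u) + σ / 2 * ∑ i, w i * u i ^ 2) +
        ∑ i, w i * ((σ + α / 2) / 2 * z i ^ 2 + β * |z i|
          - (σ * u i + (M *ᵥ lam) i / w i) * z i) := by
  have hlin : lam ⬝ᵥ (M *ᵥ z) = ∑ i, (M *ᵥ lam) i * z i := by
    rw [dotProduct_mulVec, ← mulVec_transpose, hM.eq, dotProduct]
  rw [mulVec_sub, dotProduct_sub, hlin]
  have hcancel : ∀ i, w i * ((σ + α / 2) / 2 * z i ^ 2 + β * |z i|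
      - (σ * u i + (M *ᵥ lam) i / w i) * z i) =
      α / 4 * (w i * z i ^ 2) + β * (w i * |z i|) - (M *ᵥ lam) i * z i
        + σ / 2 * (w i * (u i - z i) ^ 2) - σ / 2 * (w i * u i ^ 2) := fun i => by
    have := hw i
    field_simp
    ring
  simp only [hcancel, Finset.sum_add_distrib, Finset.sum_sub_distrib, ← Finset.mul_sum]
  ring

/-- for `α, β, σ > 0`, `a < 0 < b`, `M` symmetric positive definite,
`W = diag(w)` with positive entries, and `u, λ ∈ ℝⁿ`, the function
`z ↦ (α/4)zᵀWz + β Σᵢ wᵢ|zᵢ| + ⟨λ, M(u − z)⟩ + (σ/2)(u − z)ᵀW(u − z)`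
attains its minimum over the box `[a,b]ⁿ` at the unique point `z*` given componentwise by
`z*ᵢ = Π_{[a,b]}( soft(σuᵢ + (Mλ)ᵢ/wᵢ, β) / (σ + α/2) )`. -/
theorem stmt_3 (n : ℕ) (hn : 1 ≤ n) (α β σ a b : ℝ)
    (hα : 0 < α) (hβ : 0 < β) (hσ : 0 < σ) (ha : a < 0) (hb : 0 < b)
    (M : Matrix (Fin n) (Fin n) ℝ) (hM : M.PosDef)
    (w : Fin n → ℝ) (hw : ∀ i, 0 < w i) (u lam : Fin n → ℝ) :
    ∀ zstar : Fin n → ℝ,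
      (∀ i, zstar i =
        max a (min ((Real.sign (σ * u i + (M *ᵥ lam) i / w i) *
            max (|σ * u i + (M *ᵥ lam) i / w i| - β) 0) / (σ + α / 2)) b)) →
      (∀ i, zstar i ∈ Set.Icc a b) ∧
      IsMinOn (fun z : Fin n → ℝ =>
          α / 4 * ∑ i, w i * z i ^ 2 + β * ∑ i, w i * |z i|
            + lam ⬝ᵥ (M *ᵥ (u - z)) + σ / 2 * ∑ i, w i * (u i - z i) ^ 2)
        {z : Fin n → ℝ | ∀ i, z i ∈ Set.Icc a b} zstar ∧
      ∀ z ∈ {z : Fin n → ℝ | ∀ i, z i ∈ Set.Icc a b},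
        IsMinOn (fun z : Fin n → ℝ =>
            α / 4 * ∑ i, w i * z i ^ 2 + β * ∑ i, w i * |z i|
              + lam ⬝ᵥ (M *ᵥ (u - z)) + σ / 2 * ∑ i, w i * (u i - z i) ^ 2)
          {z : Fin n → ℝ | ∀ i, z i ∈ Set.Icc a b} z →
          z = zstar := by
  intro p hp
  have hc : 0 < σ + α / 2 := by positivity
  have hsymm : M.IsSymm := by simpa using hM.isHermitian
  have hmem : ∀ i, p i ∈ Set.Icc a b := fun i => by
    rw [hp i]
    exact ⟨le_max_left _ _, max_le (ha.trans hb).le (min_le_right _ _)⟩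
  simp only [objective_separable α β σ hsymm (fun i => (hw i).ne') u lam]
  have hgrowth : ∀ z : Fin n → ℝ, (∀ i, z i ∈ Set.Icc a b) → ∀ i, _ := fun z hz i =>
    mul_le_mul_of_nonneg_left
      (soft_proj_quadratic_growth ha hb hc hβ _ (hp i) (hz i)) (hw i).le
  have hsum := fun z hz => Finset.sum_le_sum fun i (_ : i ∈ Finset.univ) => hgrowth z hz i
  simp only [mul_sub (w _) (_ - _) (_ - _), Finset.sum_sub_distrib] at hsum
  have hnonneg : ∀ (z : Fin n → ℝ) i, 0 ≤ w i * ((σ + α / 2) / 2 * (z i - p i) ^ 2) :=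
    fun z i => mul_nonneg (hw i).le (by positivity)
  refine ⟨hmem, fun z hz => ?_, fun z hz hmin => ?_⟩
  · have := hsum z hz
    have := Finset.sum_nonneg fun i (_ : i ∈ Finset.univ) => hnonneg z i
    simp only [Set.mem_ofPred_eq]
    linarith
  · have h₁ := hsum z hz
    have h₂ := hmin hmem
    simp only [Set.mem_ofPred_eq] at h₂
    have h₀ : ∑ i, w i * ((σ + α / 2) / 2 * (z i - p i) ^ 2) = 0 :=
      le_antisymm (by linarith) (Finset.sum_nonneg fun i _ => hnonneg z i)
    funext i
    have hi := (Finset.sum_eq_zero_iff_of_nonneg fun i _ => hnonneg z i).1 h₀ i (Finset.mem_univ i)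
    simpa [(hw i).ne', hc.ne', sub_eq_zero] using hi
end

section
/- Let α > 0, β > 0, σ > 0, a < 0 < b, n ≥ 1 and c ∈ ℝⁿ. Define T : ℝⁿ → ℝⁿ componentwise by T(u)_i := Π_{[a,b]}( soft(σ u_i + c_i, β) / (σ + α/2) ). Then for all u, u' ∈ ℝⁿ one has ‖T(u) − T(u')‖ ≤ (σ/(σ + α/2)) ‖u − u'‖. In particular, if ε ≥ 0, ρ ≥ 0 and ‖u − u'‖ ≤ ρε, then ‖T(u) − T(u')‖ ≤ (ρσ/(σ + α/2)) ε. -/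
open Matrix

/-- Euclidean norm on `ℝⁿ`. -/
noncomputable def euclNorm {n : ℕ} (x : Fin n → ℝ) : ℝ := Real.sqrt (x ⬝ᵥ x)

/-- The componentwise map `T(u)ᵢ = Π_{[a,b]}( soft(σuᵢ + cᵢ, β)/(σ + α/2) )`,
where `soft(v, β) = sgn(v)·max(|v| − β, 0)` and `Π_{[a,b]}(v) = max(a, min(v, b))`. -/
noncomputable def Tmap (n : ℕ) (α β σ a b : ℝ) (c : Fin n → ℝ) (u : Fin n → ℝ) :
    Fin n → ℝ :=
  fun i => max a (min (Real.sign (σ * u i + c i) * max (|σ * u i + c i| - β) 0 / (σ + α / 2)) b)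

theorem sign_mul_max_abs_sub_eq {β : ℝ} (hβ : 0 ≤ β) (v : ℝ) :
    Real.sign v * max (|v| - β) 0 = max (v - β) 0 + min (v + β) 0 := by
  rcases lt_trichotomy v 0 with h | rfl | h
  · rw [Real.sign_of_neg h, abs_of_neg h]
    grind
  · simp [hβ]
  · rw [Real.sign_of_pos h, abs_of_pos h]
    grind

/-- Soft-thresholding is nonexpansive. -/
theorem abs_soft_sub_soft_le {β : ℝ} (hβ : 0 ≤ β) (v w : ℝ) :
    |Real.sign v * max (|v| - β) 0 - Real.sign w * max (|w| - β) 0| ≤ |v - w| := by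
  rw [sign_mul_max_abs_sub_eq hβ, sign_mul_max_abs_sub_eq hβ]
  grind

/-- Projection onto an interval is nonexpansive. -/
theorem abs_max_min_sub_max_min_le (a b v w : ℝ) :
    |max a (min v b) - max a (min w b)| ≤ |v - w| := by
  grind

theorem abs_Tmap_sub_Tmap_le {n : ℕ} {α β σ : ℝ} (hα : 0 ≤ α) (hβ : 0 ≤ β) (hσ : 0 ≤ σ)
    (a b : ℝ) (c u u' : Fin n → ℝ) (i : Fin n) :
    |Tmap n α β σ a b c u i - Tmap n α β σ a b c u' i| ≤ σ / (σ + α / 2) * |u i - u' i| := by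
  have hd : 0 ≤ σ + α / 2 := by positivity
  calc _ ≤ _ := abs_max_min_sub_max_min_le _ _ _ _
    _ ≤ |(σ * u i + c i) - (σ * u' i + c i)| / (σ + α / 2) := by
      rw [← sub_div, abs_div, abs_of_nonneg hd]
      exact div_le_div_of_nonneg_right (abs_soft_sub_soft_le hβ _ _) hd
    _ = σ / (σ + α / 2) * |u i - u' i| := by
      rw [add_sub_add_right_eq_sub, ← mul_sub, abs_mul, abs_of_nonneg hσ]
      ring

theorem euclNorm_le_mul_of_abs_le {n : ℕ} {k : ℝ} (hk : 0 ≤ k) {x y : Fin n → ℝ}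
    (h : ∀ i, |x i| ≤ k * |y i|) : euclNorm x ≤ k * euclNorm y := by
  unfold euclNorm
  rw [← Real.sqrt_sq hk, ← Real.sqrt_mul (sq_nonneg k)]
  apply Real.sqrt_le_sqrt
  rw [dotProduct, dotProduct, Finset.mul_sum]
  refine Finset.sum_le_sum fun i _ => ?_
  calc x i * x i = |x i| * |x i| := (abs_mul_abs_self _).symm
    _ ≤ (k * |y i|) * (k * |y i|) := mul_self_le_mul_self (abs_nonneg _) (h i)
    _ = k ^ 2 * (y i * y i) := by rw [← abs_mul_abs_self (y i)]; ring

/-- `T` is Lipschitz with constant `σ/(σ + α/2)` in the Euclidean norm; in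
particular, if `‖u − u'‖ ≤ ρε` with `ε, ρ ≥ 0`, then `‖T(u) − T(u')‖ ≤ (ρσ/(σ + α/2))ε`. -/
theorem stmt_5 (n : ℕ) (hn : 1 ≤ n) (α β σ a b : ℝ)
    (hα : 0 < α) (hβ : 0 < β) (hσ : 0 < σ) (ha : a < 0) (hb : 0 < b)
    (c : Fin n → ℝ) :
    (∀ u u' : Fin n → ℝ,
      euclNorm (Tmap n α β σ a b c u - Tmap n α β σ a b c u')
        ≤ σ / (σ + α / 2) * euclNorm (u - u')) ∧
    (∀ u u' : Fin n → ℝ, ∀ ε ρ : ℝ, 0 ≤ ε → 0 ≤ ρ → euclNorm (u - u') ≤ ρ * ε →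
      euclNorm (Tmap n α β σ a b c u - Tmap n α β σ a b c u')
        ≤ ρ * σ / (σ + α / 2) * ε) := by
  have hk : 0 ≤ σ / (σ + α / 2) := by positivity
  have hT (u u' : Fin n → ℝ) :
      euclNorm (Tmap n α β σ a b c u - Tmap n α β σ a b c u')
        ≤ σ / (σ + α / 2) * euclNorm (u - u') :=
    euclNorm_le_mul_of_abs_le hk (abs_Tmap_sub_Tmap_le hα.le hβ.le hσ.le a b c u u')
  refine ⟨hT, fun u u' ε ρ _ _ h => (hT u u').trans ?_⟩
  calc σ / (σ + α / 2) * euclNorm (u - u') ≤ σ / (σ + α / 2) * (ρ * ε) := by gcongr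
    _ = ρ * σ / (σ + α / 2) * ε := by ring
end

section
/- Let τ ∈ (0, 1] and σ ∈ (0, α/4]. Assume ‖x‖²_M ≤ ‖x‖²_W ≤ 5‖x‖²_M for every x ∈ ℝⁿ and that W − τM is positive definite. Let (u*, z*, λ*) be a KKT point. Let (ε_k)_{k≥0} be nonnegative reals with Σ_{k=0}^∞ ε_k < ∞, and let sequences (u^k), (z^k), (λ^k), (δ^k) in ℝⁿ satisfy, for every k ≥ 0: z^k ∈ [a, b]ⁿ; ‖δ^k‖ ≤ ε_k; δ^k − Mλ^k − σM(u^{k+1} − z^k) = ∇f(u^{k+1}); Mλ^k + σW(u^{k+1} − z^{k+1}) is a subgradient of g at z^{k+1} ∈ [a, b]ⁿ; and λ^{k+1} = λ^k + τσ(u^{k+1} − z^{k+1}). Then ‖u^k − u*‖ + ‖z^k − z*‖ + ‖λ^k − λ*‖ → 0 as k → ∞. -/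
open Matrix

/-- Quadratic form `‖x‖²_A := xᵀAx`. -/
noncomputable def qForm {n : ℕ} (A : Matrix (Fin n) (Fin n) ℝ) (x : Fin n → ℝ) : ℝ :=
  x ⬝ᵥ (A *ᵥ x)

/-- `Σ_f := (α/2)M + MK⁻¹MK⁻¹M`. -/
noncomputable def Sigf {n : ℕ} (α : ℝ) (M K : Matrix (Fin n) (Fin n) ℝ) :
    Matrix (Fin n) (Fin n) ℝ :=
  (α / 2) • M + M * K⁻¹ * M * K⁻¹ * M

/-- `∇f(u) := Σ_f u + MK⁻¹MK⁻¹M y_c − MK⁻¹M y_d`. -/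
noncomputable def gradf {n : ℕ} (α : ℝ) (M K : Matrix (Fin n) (Fin n) ℝ)
    (yc yd : Fin n → ℝ) (u : Fin n → ℝ) : Fin n → ℝ :=
  Sigf α M K *ᵥ u + (M * K⁻¹ * M * K⁻¹ * M) *ᵥ yc - (M * K⁻¹ * M) *ᵥ yd

/-- `g(z) = (α/4)‖z‖²_W + β Σᵢ wᵢ|zᵢ|` for `W = diag(w)`. -/
noncomputable def gfun {n : ℕ} (α β : ℝ) (w : Fin n → ℝ) (z : Fin n → ℝ) : ℝ :=
  α / 4 * ∑ i, w i * z i ^ 2 + β * ∑ i, w i * |z i|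

/-- `φ` is a subgradient of `g` at `z ∈ [a,b]ⁿ`. -/
def IsSubgrad {n : ℕ} (α β a b : ℝ) (w : Fin n → ℝ) (z φ : Fin n → ℝ) : Prop :=
  ∀ v : Fin n → ℝ, (∀ i, v i ∈ Set.Icc a b) → gfun α β w z + φ ⬝ᵥ (v - z) ≤ gfun α β w v

/-- `(u*, z*, λ*)` is a KKT point. -/
def IsKKT {n : ℕ} (α β a b : ℝ) (M K : Matrix (Fin n) (Fin n) ℝ) (w : Fin n → ℝ)
    (yc yd : Fin n → ℝ) (ustar zstar lstar : Fin n → ℝ) : Prop :=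
  -(M *ᵥ lstar) = gradf α M K yc yd ustar ∧
  (∀ i, zstar i ∈ Set.Icc a b) ∧
  IsSubgrad α β a b w zstar (M *ᵥ lstar) ∧
  ustar = zstar

section Helpers

variable {n : ℕ}

theorem sq_apply_le_dotProduct_self (x : Fin n → ℝ) (i : Fin n) : x i ^ 2 ≤ x ⬝ᵥ x := by
  have h := Finset.single_le_sum (f := fun j => x j * x j) (fun j _ => mul_self_nonneg (x j))
    (Finset.mem_univ i)
  simpa [dotProduct, sq] using h

theorem tendsto_zero_of_dotProduct_self {x : ℕ → Fin n → ℝ}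
    (h : Filter.Tendsto (fun k => x k ⬝ᵥ x k) Filter.atTop (nhds 0)) :
    Filter.Tendsto x Filter.atTop (nhds 0) := by
  refine tendsto_pi_nhds.2 fun i => ?_
  have hsq : Filter.Tendsto (fun k => x k i ^ 2) Filter.atTop (nhds 0) :=
    squeeze_zero (fun k => sq_nonneg _) (fun k => sq_apply_le_dotProduct_self (x k) i) h
  have habs := (Real.continuous_sqrt.tendsto 0).comp hsq
  simp only [Function.comp_def, Real.sqrt_sq_eq_abs, Real.sqrt_zero] at habs
  exact (tendsto_zero_iff_abs_tendsto_zero _).2 habs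

theorem tendsto_euclNorm_zero {x : ℕ → Fin n → ℝ}
    (h : Filter.Tendsto x Filter.atTop (nhds 0)) :
    Filter.Tendsto (fun k => euclNorm (x k)) Filter.atTop (nhds 0) := by
  have hc : Continuous (euclNorm : (Fin n → ℝ) → ℝ) := by
    unfold euclNorm
    exact Real.continuous_sqrt.comp (continuous_id.dotProduct continuous_id)
  simpa [euclNorm, Function.comp_def] using (hc.tendsto 0).comp h

theorem dotProduct_self_nonneg_real (x : Fin n → ℝ) : 0 ≤ x ⬝ᵥ x :=
  Finset.sum_nonneg fun i _ => mul_self_nonneg (x i)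

theorem qForm_smul (A : Matrix (Fin n) (Fin n) ℝ) (c : ℝ) (x : Fin n → ℝ) :
    qForm A (c • x) = c ^ 2 * qForm A x := by
  simp only [qForm, mulVec_smul, dotProduct_smul, smul_dotProduct, smul_eq_mul]
  ring

theorem qForm_add {A : Matrix (Fin n) (Fin n) ℝ} (hA : A.IsSymm) (x y : Fin n → ℝ) :
    qForm A (x + y) = qForm A x + 2 * (x ⬝ᵥ A *ᵥ y) + qForm A y := by
  have h : y ⬝ᵥ A *ᵥ x = x ⬝ᵥ A *ᵥ y := by
    rw [dotProduct_comm, dotProduct_mulVec, ← mulVec_transpose, hA.eq]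
  simp only [qForm, mulVec_add, dotProduct_add, add_dotProduct, h]
  ring

theorem qForm_sub {A : Matrix (Fin n) (Fin n) ℝ} (hA : A.IsSymm) (x y : Fin n → ℝ) :
    qForm A (x - y) = qForm A x - 2 * (x ⬝ᵥ A *ᵥ y) + qForm A y := by
  have h := qForm_add hA x (-y)
  have h' : qForm A (-y) = qForm A y := by simp [qForm, mulVec_neg]
  rw [h', mulVec_neg, dotProduct_neg, ← sub_eq_add_neg] at h
  linarith

theorem qForm_diagonal (w x : Fin n → ℝ) :
    qForm (diagonal w) x = ∑ i, w i * x i ^ 2 := by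
  simp only [qForm, dotProduct, mulVec_diagonal]
  exact Finset.sum_congr rfl fun i _ => by ring

theorem qForm_nonneg {A : Matrix (Fin n) (Fin n) ℝ} (hA : A.PosSemidef) (x : Fin n → ℝ) :
    0 ≤ qForm A x := by
  simpa [qForm] using hA.dotProduct_mulVec_nonneg x

theorem continuous_qForm (A : Matrix (Fin n) (Fin n) ℝ) : Continuous (qForm A) := by
  unfold qForm
  exact continuous_id.dotProduct (continuous_const.matrix_mulVec continuous_id)

theorem dotProduct_le_of_sq_le {x y : Fin n → ℝ} {e c : ℝ} (hc : 0 < c)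
    (hx : x ⬝ᵥ x ≤ e ^ 2) : x ⬝ᵥ y ≤ c * (y ⬝ᵥ y) + e ^ 2 / (4 * c) := by
  have h := dotProduct_self_nonneg_real (x - (2 * c) • y)
  simp only [dotProduct_sub, sub_dotProduct, dotProduct_smul, smul_dotProduct, smul_eq_mul,
    dotProduct_comm y x] at h
  have h4 : x ⬝ᵥ y - c * (y ⬝ᵥ y) ≤ e ^ 2 / (4 * c) := by
    rw [le_div_iff₀ (by positivity)]
    nlinarith
  linarith

theorem dotProduct_add_self_le (x y : Fin n → ℝ) :
    (x + y) ⬝ᵥ (x + y) ≤ 2 * (x ⬝ᵥ x + y ⬝ᵥ y) := by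
  have h := dotProduct_self_nonneg_real (x - y)
  simp only [dotProduct_sub, sub_dotProduct, dotProduct_add, add_dotProduct] at h ⊢
  linarith

theorem exists_pos_mul_dotProduct_le_qForm {A : Matrix (Fin n) (Fin n) ℝ} (hA : A.PosDef) :
    ∃ c > 0, ∀ x : Fin n → ℝ, c * (x ⬝ᵥ x) ≤ qForm A x := by
  rcases (Metric.sphere (0 : Fin n → ℝ) 1).eq_empty_or_nonempty with he | hne
  · refine ⟨1, one_pos, fun x => ?_⟩
    have hx : x = 0 := by
      by_contra hx
      have : (‖x‖⁻¹ • x) ∈ Metric.sphere (0 : Fin n → ℝ) 1 := by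
        simp [norm_smul, norm_ne_zero_iff.2 hx]
      simp [he] at this
    simp [hx, qForm]
  have hpos : ∀ x : Fin n → ℝ, x ≠ 0 → 0 < qForm A x := fun x hx => by
    simpa [qForm] using hA.dotProduct_mulVec_pos hx
  have hcpt := isCompact_sphere (0 : Fin n → ℝ) 1
  have hcd : Continuous fun x : Fin n → ℝ => x ⬝ᵥ x := continuous_id.dotProduct continuous_id
  obtain ⟨x₀, hx₀, hmin⟩ := hcpt.exists_isMinOn hne (continuous_qForm A).continuousOn
  obtain ⟨x₁, hx₁, hmax⟩ := hcpt.exists_isMaxOn hne hcd.continuousOn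
  have hx₀' : x₀ ≠ 0 := by rintro rfl; simp at hx₀
  set m := qForm A x₀ with hm
  set B := x₁ ⬝ᵥ x₁ with hB
  have hmpos : 0 < m := hpos _ hx₀'
  have hB0 : 0 ≤ B := dotProduct_self_nonneg_real _
  refine ⟨m / (B + 1), by positivity, fun x => ?_⟩
  rcases eq_or_ne x 0 with rfl | hx
  · simp [qForm]
  have hxn : 0 < ‖x‖ := norm_pos_iff.2 hx
  have hy : (‖x‖⁻¹ • x) ∈ Metric.sphere (0 : Fin n → ℝ) 1 := by
    simp [norm_smul, hxn.ne']
  have h1 : m ≤ qForm A (‖x‖⁻¹ • x) := hmin hy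
  have h2 : (‖x‖⁻¹ • x) ⬝ᵥ (‖x‖⁻¹ • x) ≤ B := hmax hy
  have hs : x = ‖x‖ • (‖x‖⁻¹ • x) := by
    rw [smul_smul, mul_inv_cancel₀ hxn.ne', one_smul]
  generalize ‖x‖⁻¹ • x = y at hs h1 h2
  have hxd : x ⬝ᵥ x = ‖x‖ ^ 2 * (y ⬝ᵥ y) := by
    conv_lhs => rw [hs]
    simp only [dotProduct_smul, smul_dotProduct, smul_eq_mul]
    ring
  have hxq : qForm A x = ‖x‖ ^ 2 * qForm A y := by
    conv_lhs => rw [hs]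
    rw [qForm_smul]
  rw [hxd, hxq, mul_left_comm]
  gcongr
  calc m / (B + 1) * (y ⬝ᵥ y) ≤ m / (B + 1) * (B + 1) := by gcongr; linarith
    _ = m := by field_simp
    _ ≤ _ := h1

theorem qForm_Sigf_ge (α : ℝ) {M K : Matrix (Fin n) (Fin n) ℝ} (hM : M.PosDef)
    (hK : K.PosDef) (x : Fin n → ℝ) : α / 2 * qForm M x ≤ qForm (Sigf α M K) x := by
  have hMt : Mᵀ = M := by simpa using hM.isHermitian.eq
  have hKt : (K⁻¹)ᵀ = K⁻¹ := by simpa using hK.isHermitian.inv.eq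
  have h := qForm_nonneg hM.posSemidef ((K⁻¹ * M) *ᵥ x)
  have he : qForm M ((K⁻¹ * M) *ᵥ x) = x ⬝ᵥ (M * K⁻¹ * M * K⁻¹ * M) *ᵥ x := by
    have ht : M * K⁻¹ * M * K⁻¹ * M = (K⁻¹ * M)ᵀ * (M * (K⁻¹ * M)) := by
      rw [transpose_mul, hMt, hKt]
      simp only [Matrix.mul_assoc]
    rw [ht, ← mulVec_mulVec x (K⁻¹ * M)ᵀ, dotProduct_mulVec, vecMul_transpose,
      ← mulVec_mulVec x M, qForm]
  have hs : qForm (Sigf α M K) x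
      = α / 2 * qForm M x + x ⬝ᵥ (M * K⁻¹ * M * K⁻¹ * M) *ᵥ x := by
    simp only [qForm, Sigf, add_mulVec, smul_mulVec, dotProduct_add, dotProduct_smul, smul_eq_mul]
  linarith

theorem gfun_lineMap_le {α β : ℝ} (hβ : 0 < β) {w : Fin n → ℝ} (hw : ∀ i, 0 < w i)
    (x y : Fin n → ℝ) {t : ℝ} (ht₀ : 0 ≤ t) (ht₁ : t ≤ 1) :
    gfun α β w (x + t • (y - x)) ≤ gfun α β w x + t * (gfun α β w y - gfun α β w x)
      - t * (1 - t) * (α / 4 * qForm (diagonal w) (y - x)) := by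
  have hquad : ∑ i, w i * (x + t • (y - x)) i ^ 2
      = (1 - t) * ∑ i, w i * x i ^ 2 + t * ∑ i, w i * y i ^ 2
        - t * (1 - t) * ∑ i, w i * (y - x) i ^ 2 := by
    simp only [Finset.mul_sum, ← Finset.sum_add_distrib, ← Finset.sum_sub_distrib]
    refine Finset.sum_congr rfl fun i _ => ?_
    simp only [Pi.add_apply, Pi.smul_apply, Pi.sub_apply, smul_eq_mul]
    ring
  have habs : ∑ i, w i * |(x + t • (y - x)) i|
      ≤ (1 - t) * ∑ i, w i * |x i| + t * ∑ i, w i * |y i| := by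
    simp only [Finset.mul_sum, ← Finset.sum_add_distrib]
    refine Finset.sum_le_sum fun i _ => ?_
    have h : |(x + t • (y - x)) i| ≤ (1 - t) * |x i| + t * |y i| := by
      have he : (x + t • (y - x)) i = (1 - t) * x i + t * y i := by
        simp only [Pi.add_apply, Pi.smul_apply, Pi.sub_apply, smul_eq_mul]
        ring
      rw [he]
      refine (abs_add_le _ _).trans_eq ?_
      rw [abs_mul, abs_mul, abs_of_nonneg ht₀, abs_of_nonneg (sub_nonneg.2 ht₁)]
    nlinarith [mul_le_mul_of_nonneg_left h (hw i).le]
  rw [qForm_diagonal]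
  unfold gfun
  rw [hquad]
  nlinarith [mul_le_mul_of_nonneg_left habs hβ.le]

theorem IsSubgrad.add_qForm_le {α β a b : ℝ} (hα : 0 < α) (hβ : 0 < β) {w : Fin n → ℝ}
    (hw : ∀ i, 0 < w i) {x φ : Fin n → ℝ} (hx : ∀ i, x i ∈ Set.Icc a b)
    (h : IsSubgrad α β a b w x φ) {y : Fin n → ℝ} (hy : ∀ i, y i ∈ Set.Icc a b) :
    gfun α β w x + φ ⬝ᵥ (y - x) + α / 4 * qForm (diagonal w) (y - x) ≤ gfun α β w y := by
  set Y := α / 4 * qForm (diagonal w) (y - x) with hY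
  have hY0 : 0 ≤ Y := by
    rw [hY, qForm_diagonal]
    exact mul_nonneg (by positivity)
      (Finset.sum_nonneg fun i _ => mul_nonneg (hw i).le (sq_nonneg _))
  by_contra! hcon
  obtain ⟨X, hX⟩ : ∃ X, X = gfun α β w x + φ ⬝ᵥ (y - x) + Y - gfun α β w y := ⟨_, rfl⟩
  have hX0 : 0 < X := by linarith
  obtain ⟨t, ht⟩ : ∃ t, t = X / (X + Y) := ⟨_, rfl⟩
  have ht0 : 0 < t := by rw [ht]; positivity
  have htX : t * (X + Y) = X := by rw [ht]; field_simp
  have ht1 : t ≤ 1 := by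
    rw [ht, div_le_one (by positivity)]
    linarith
  have hbox : ∀ i, (x + t • (y - x)) i ∈ Set.Icc a b := fun i => by
    simpa using (convex_Icc a b).add_smul_sub_mem (hx i) (hy i) ⟨ht0.le, ht1⟩
  have h1 := h _ hbox
  have h2 := gfun_lineMap_le (α := α) hβ hw x y ht0.le ht1
  rw [← hY] at h2
  rw [add_sub_cancel_left, dotProduct_smul, smul_eq_mul] at h1
  have h3 : t * X ≤ t * (t * Y) := by
    rw [hX]
    linarith
  have h4 := le_of_mul_le_mul_left h3 ht0
  nlinarith [mul_pos ht0 hX0]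

theorem IsSubgrad.strongly_monotone {α β a b : ℝ} (hα : 0 < α) (hβ : 0 < β) {w : Fin n → ℝ}
    (hw : ∀ i, 0 < w i) {x y φ ψ : Fin n → ℝ} (hx : ∀ i, x i ∈ Set.Icc a b)
    (hy : ∀ i, y i ∈ Set.Icc a b) (hφ : IsSubgrad α β a b w x φ)
    (hψ : IsSubgrad α β a b w y ψ) :
    α / 2 * qForm (diagonal w) (x - y) ≤ (x - y) ⬝ᵥ (φ - ψ) := by
  have h1 := hφ.add_qForm_le hα hβ hw hx hy
  have h2 := hψ.add_qForm_le hα hβ hw hy hx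
  have h3 : qForm (diagonal w) (y - x) = qForm (diagonal w) (x - y) := by
    have := qForm_smul (diagonal w) (-1) (x - y)
    simpa using this
  rw [h3] at h1
  simp only [dotProduct_sub, dotProduct_comm _ φ, dotProduct_comm _ ψ] at h1 h2 ⊢
  linarith

/-- One-step energy estimate, in terms of the errors `Z` and `L` of the old iterate, the error `P`
of the new `z`-iterate and the primal residual `r`. -/
theorem admm_energy_step {α τ σ c : ℝ} {M K : Matrix (Fin n) (Fin n) ℝ} {w : Fin n → ℝ}
    (hM : M.PosDef) (hK : K.PosDef) (hτ : 0 < τ) (hσ : σ ∈ Set.Ioc 0 (α / 4))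
    (hMW : ∀ x : Fin n → ℝ,
      qForm M x ≤ qForm (diagonal w) x ∧ qForm (diagonal w) x ≤ 5 * qForm M x)
    (hc : ∀ x : Fin n → ℝ, c * (x ⬝ᵥ x) ≤ α / 2 * qForm (diagonal w) x ∧
      c * (x ⬝ᵥ x) ≤ σ / 2 * qForm (diagonal w - τ • M) x)
    {Z P r L d : Fin n → ℝ}
    (hU : d - M *ᵥ L - σ • (M *ᵥ (P + r - Z)) = Sigf α M K *ᵥ (P + r))
    (hP : α / 2 * qForm (diagonal w) P ≤ P ⬝ᵥ (M *ᵥ L + σ • (diagonal w *ᵥ r))) :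
    qForm M (L + (τ * σ) • r) / (2 * τ * σ) + σ / 2 * qForm (diagonal w) P
        + c * (P ⬝ᵥ P + r ⬝ᵥ r)
      ≤ qForm M L / (2 * τ * σ) + σ / 2 * qForm (diagonal w) Z + d ⬝ᵥ (P + r) := by
  obtain ⟨hσ0, hσα⟩ := hσ
  have hMs : M.IsSymm := by simpa [IsSymm] using hM.isHermitian.eq
  have hWs : (diagonal w).IsSymm := isSymm_diagonal w
  have hL : qForm M (L + (τ * σ) • r) / (2 * τ * σ)
      = qForm M L / (2 * τ * σ) + L ⬝ᵥ M *ᵥ r + τ * σ / 2 * qForm M r := by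
    rw [qForm_add hMs, qForm_smul, mulVec_smul, dotProduct_smul, smul_eq_mul]
    field_simp
  have hLr : L ⬝ᵥ M *ᵥ r = r ⬝ᵥ M *ᵥ L := by
    rw [dotProduct_mulVec, ← mulVec_transpose, hMs.eq, dotProduct_comm]
  have hUZ := qForm_sub hMs (P + r) Z
  have hUZ0 := qForm_nonneg hM.posSemidef (P + r - Z)
  have hWU := qForm_add hWs P r
  have hr : qForm (diagonal w - τ • M) r = qForm (diagonal w) r - τ * qForm M r := by
    simp only [qForm, sub_mulVec, smul_mulVec, dotProduct_sub, dotProduct_smul, smul_eq_mul]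
  have hdot := congrArg (fun v => (P + r) ⬝ᵥ v) hU
  have hSig := qForm_Sigf_ge α hM hK (P + r)
  have hUL : (P + r) ⬝ᵥ M *ᵥ L = P ⬝ᵥ M *ᵥ L + r ⬝ᵥ M *ᵥ L := add_dotProduct _ _ _
  have hd : d ⬝ᵥ (P + r) = (P + r) ⬝ᵥ d := dotProduct_comm _ _
  have hMU := qForm_nonneg hM.posSemidef (P + r)
  have h5 := mul_le_mul_of_nonneg_left (hMW (P + r)).2 hσ0.le
  have h1 := mul_le_mul_of_nonneg_left (hMW Z).1 hσ0.le
  have hα := mul_le_mul_of_nonneg_right hσα hMU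
  have hcP := (hc P).1
  have hcr := (hc r).2
  rw [dotProduct_add, dotProduct_smul, smul_eq_mul] at hP
  simp only [dotProduct_sub, mulVec_sub, dotProduct_smul, smul_eq_mul] at hdot
  change _ = qForm (Sigf α M K) (P + r) at hdot
  change (P + r) ⬝ᵥ d - (P + r) ⬝ᵥ M *ᵥ L - σ * (qForm M (P + r) - (P + r) ⬝ᵥ M *ᵥ Z) = _ at hdot
  rw [hL, hLr, hd]
  rw [hr] at hcr
  have hUZ' := mul_nonneg hσ0.le hUZ0
  rw [hUZ] at hUZ'
  rw [hWU] at h5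
  nlinarith

theorem tendsto_zero_of_energy_le {V D e : ℕ → ℝ} (hV : ∀ k, 0 ≤ V k) (hD : ∀ k, 0 ≤ D k)
    (he0 : ∀ k, 0 ≤ e k) (he : Summable e) (h : ∀ k, V (k + 1) + D k ≤ V k + e k) :
    Filter.Tendsto D Filter.atTop (nhds 0) := by
  have hsum : ∀ N, V N + ∑ k ∈ Finset.range N, D k ≤ V 0 + ∑ k ∈ Finset.range N, e k := by
    intro N
    induction N with
    | zero => simp
    | succ N ih =>
      rw [Finset.sum_range_succ, Finset.sum_range_succ]
      linarith [h N]
  refine (summable_of_sum_range_le (c := V 0 + ∑' k, e k) hD fun N => ?_).tendsto_atTop_zero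
  linarith [hsum N, hV N, he.sum_le_tsum (Finset.range N) fun k _ => he0 k]

end Helpers

/-- global convergence of the inexact heterogeneous ADMM: under the stated
conditions, `‖u^k − u*‖ + ‖z^k − z*‖ + ‖λ^k − λ*‖ → 0` as `k → ∞`. -/
theorem stmt_10 (n : ℕ) (hn : 1 ≤ n) (α β a b : ℝ)
    (hα : 0 < α) (hβ : 0 < β) (ha : a < 0) (hb : 0 < b)
    (M K : Matrix (Fin n) (Fin n) ℝ) (hM : M.PosDef) (hK : K.PosDef)
    (w : Fin n → ℝ) (hw : ∀ i, 0 < w i) (yc yd : Fin n → ℝ)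
    (τ σ : ℝ) (hτ : τ ∈ Set.Ioc 0 1) (hσ : σ ∈ Set.Ioc 0 (α / 4))
    (hMW : ∀ x : Fin n → ℝ,
      qForm M x ≤ qForm (Matrix.diagonal w) x ∧ qForm (Matrix.diagonal w) x ≤ 5 * qForm M x)
    (hWτM : (Matrix.diagonal w - τ • M).PosDef)
    (ustar zstar lstar : Fin n → ℝ)
    (hkkt : IsKKT α β a b M K w yc yd ustar zstar lstar)
    (ε : ℕ → ℝ) (hε : ∀ k, 0 ≤ ε k) (hεsum : Summable ε)
    (u z lam δ : ℕ → Fin n → ℝ)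
    (hzbox : ∀ k, ∀ i, z k i ∈ Set.Icc a b)
    (hδ : ∀ k, euclNorm (δ k) ≤ ε k)
    (hu : ∀ k, δ k - M *ᵥ lam k - σ • (M *ᵥ (u (k + 1) - z k))
      = gradf α M K yc yd (u (k + 1)))
    (hzsub : ∀ k, IsSubgrad α β a b w (z (k + 1))
      (M *ᵥ lam k + σ • (Matrix.diagonal w *ᵥ (u (k + 1) - z (k + 1)))))
    (hlam : ∀ k, lam (k + 1) = lam k + (τ * σ) • (u (k + 1) - z (k + 1))) :
    Filter.Tendsto
      (fun k => euclNorm (u k - ustar) + euclNorm (z k - zstar) + euclNorm (lam k - lstar))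
      Filter.atTop (nhds 0) := by
  obtain ⟨hgrad, hzs, hsub, rfl⟩ := hkkt
  obtain ⟨hτ0, -⟩ := hτ
  have hσ0 : 0 < σ := hσ.1
  have hW : (diagonal w).PosDef := PosDef.diagonal hw
  obtain ⟨c₁, hc₁, hcW⟩ := exists_pos_mul_dotProduct_le_qForm hW
  obtain ⟨c₂, hc₂, hcD⟩ := exists_pos_mul_dotProduct_le_qForm hWτM
  obtain ⟨c, hcdef⟩ : ∃ c, c = min (α / 2 * c₁) (σ / 2 * c₂) := ⟨_, rfl⟩
  have hc : 0 < c := by rw [hcdef]; positivity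
  have hcle : ∀ x : Fin n → ℝ, c * (x ⬝ᵥ x) ≤ α / 2 * qForm (diagonal w) x ∧
      c * (x ⬝ᵥ x) ≤ σ / 2 * qForm (diagonal w - τ • M) x := by
    intro x
    have hx := dotProduct_self_nonneg_real x
    have h1 := mul_le_mul_of_nonneg_right (hcdef ▸ min_le_left (α / 2 * c₁) (σ / 2 * c₂)) hx
    have h2 := mul_le_mul_of_nonneg_right (hcdef ▸ min_le_right (α / 2 * c₁) (σ / 2 * c₂)) hx
    have h3 := mul_le_mul_of_nonneg_left (hcW x) (by positivity : 0 ≤ α / 2)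
    have h4 := mul_le_mul_of_nonneg_left (hcD x) (by positivity : 0 ≤ σ / 2)
    constructor <;> linarith
  set Z : ℕ → Fin n → ℝ := fun k => z k - ustar with hZ
  set L : ℕ → Fin n → ℝ := fun k => lam k - lstar with hL
  set r : ℕ → Fin n → ℝ := fun k => u (k + 1) - z (k + 1) with hr
  have hZr : ∀ k, Z (k + 1) + r k = u (k + 1) - ustar := fun k => by
    simp only [hZ, hr]; abel
  have hUeq : ∀ k, δ k - M *ᵥ L k - σ • (M *ᵥ (Z (k + 1) + r k - Z k))
      = Sigf α M K *ᵥ (Z (k + 1) + r k) := by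
    intro k
    have h1 := hu k
    have h2 : Z (k + 1) + r k - Z k = u (k + 1) - z k := by
      simp only [hZ, hr]; abel
    rw [h2, hZr, mulVec_sub (Sigf α M K)]
    simp only [gradf] at h1 hgrad
    have h3 : M *ᵥ L k = M *ᵥ lam k - M *ᵥ lstar := mulVec_sub _ _ _
    rw [h3]
    linear_combination h1 - hgrad
  have hPle : ∀ k, α / 2 * qForm (diagonal w) (Z (k + 1))
      ≤ Z (k + 1) ⬝ᵥ (M *ᵥ L k + σ • (diagonal w *ᵥ r k)) := by
    intro k
    refine (IsSubgrad.strongly_monotone hα hβ hw (hzbox (k + 1)) hzs (hzsub k) hsub).trans_eq ?_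
    congr 1
    simp only [hL, hr, mulVec_sub]
    abel
  have hδsq : ∀ k, δ k ⬝ᵥ δ k ≤ ε k ^ 2 := fun k =>
    (Real.sqrt_le_left (hε k)).1 (hδ k)
  have hε2 : Summable fun k => ε k ^ 2 := by
    have h := (hεsum.mul_of_nonneg hεsum hε hε).comp_injective
      (i := fun k => (k, k)) fun _ _ hk => (Prod.ext_iff.1 hk).1
    simpa [sq, Function.comp_def] using h
  have hD : Filter.Tendsto
      (fun k => c / 2 * (Z (k + 1) ⬝ᵥ Z (k + 1) + r k ⬝ᵥ r k)) Filter.atTop (nhds 0) := by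
    refine tendsto_zero_of_energy_le
      (V := fun k => qForm M (L k) / (2 * τ * σ) + σ / 2 * qForm (diagonal w) (Z k))
      (e := fun k => ε k ^ 2 / (4 * (c / 4))) (fun k => ?_) (fun k => ?_) (fun k => ?_)
      (hε2.div_const _) fun k => ?_
    · have h1 := qForm_nonneg hM.posSemidef (L k)
      have h2 := qForm_nonneg hW.posSemidef (Z k)
      positivity
    · have h1 := dotProduct_self_nonneg_real (Z (k + 1))
      have h2 := dotProduct_self_nonneg_real (r k)
      positivity
    · positivity
    · have h1 := admm_energy_step hM hK hτ0 hσ hMW hcle (hUeq k) (hPle k)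
      have h2 : L (k + 1) = L k + (τ * σ) • r k := by
        simp only [hL, hr, hlam k]; abel
      have h3 := dotProduct_le_of_sq_le (y := Z (k + 1) + r k) (by positivity : 0 < c / 4)
        (hδsq k)
      have h4 := mul_le_mul_of_nonneg_left (dotProduct_add_self_le (Z (k + 1)) (r k))
        (by positivity : 0 ≤ c / 4)
      rw [← h2] at h1
      linarith
  have hD' : Filter.Tendsto (fun k => Z (k + 1) ⬝ᵥ Z (k + 1) + r k ⬝ᵥ r k)
      Filter.atTop (nhds 0) := by
    have h := hD.const_mul (c / 2)⁻¹
    rw [mul_zero] at h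
    refine h.congr fun k => ?_
    field_simp
  have hZ1 : Filter.Tendsto (fun k => Z (k + 1)) Filter.atTop (nhds 0) :=
    tendsto_zero_of_dotProduct_self <| squeeze_zero (fun k => dotProduct_self_nonneg_real _)
      (fun k => le_add_of_nonneg_right (dotProduct_self_nonneg_real _)) hD'
  have hr0 : Filter.Tendsto r Filter.atTop (nhds 0) :=
    tendsto_zero_of_dotProduct_self <| squeeze_zero (fun k => dotProduct_self_nonneg_real _)
      (fun k => le_add_of_nonneg_left (dotProduct_self_nonneg_real _)) hD'
  have hZ0 : Filter.Tendsto Z Filter.atTop (nhds 0) := (Filter.tendsto_add_atTop_iff_nat 1).1 hZ1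
  have hU1 : Filter.Tendsto (fun k => Z (k + 1) + r k) Filter.atTop (nhds 0) := by
    simpa using hZ1.add hr0
  have hU0 : Filter.Tendsto (fun k => u k - ustar) Filter.atTop (nhds 0) :=
    (Filter.tendsto_add_atTop_iff_nat 1).1 (hU1.congr hZr)
  have hδ0 : Filter.Tendsto δ Filter.atTop (nhds 0) :=
    tendsto_zero_of_dotProduct_self <| squeeze_zero (fun k => dotProduct_self_nonneg_real _)
      hδsq hε2.tendsto_atTop_zero
  have hmv : ∀ (A : Matrix (Fin n) (Fin n) ℝ) {x : ℕ → Fin n → ℝ},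
      Filter.Tendsto x Filter.atTop (nhds 0) →
      Filter.Tendsto (fun k => A *ᵥ x k) Filter.atTop (nhds 0) := by
    intro A x hx
    have hA : Continuous fun v : Fin n → ℝ => A *ᵥ v :=
      continuous_const.matrix_mulVec continuous_id
    simpa [Function.comp_def] using (hA.tendsto 0).comp hx
  have hL0 : Filter.Tendsto L Filter.atTop (nhds 0) := by
    have hUZ : Filter.Tendsto (fun k => Z (k + 1) + r k - Z k) Filter.atTop (nhds 0) := by
      simpa using hU1.sub hZ0
    have h1 := (hδ0.sub ((hmv M hUZ).const_smul σ)).sub (hmv (Sigf α M K) hU1)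
    simp only [smul_zero, sub_zero] at h1
    refine (hmv M⁻¹ h1).congr fun k => ?_
    have h2 : δ k - σ • (M *ᵥ (Z (k + 1) + r k - Z k)) - Sigf α M K *ᵥ (Z (k + 1) + r k)
        = M *ᵥ L k := by
      rw [← hUeq k]; abel
    rw [h2, mulVec_mulVec, nonsing_inv_mul _ hM.det_pos.ne'.isUnit, one_mulVec]
  simpa using ((tendsto_euclNorm_zero hU0).add (tendsto_euclNorm_zero hZ0)).add
    (tendsto_euclNorm_zero hL0)
end

section
/- A pair (u*, z*) with z* ∈ [a, b]ⁿ and u* = z* minimizes f(u) + g(z) over all pairs (u, z) with u ∈ ℝⁿ, z ∈ [a, b]ⁿ and u = z if and only if there exists λ* ∈ ℝⁿ such that −Mλ* = ∇f(u*) and Mλ* is a subgradient of g at z*; moreover, such a minimizing pair is unique. -/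
open Matrix

/-- `f(u) = (1/2)‖K⁻¹M(u + y_c) − y_d‖²_M + (α/4)‖u‖²_M`. -/
noncomputable def ffun {n : ℕ} (α : ℝ) (M K : Matrix (Fin n) (Fin n) ℝ)
    (yc yd : Fin n → ℝ) (u : Fin n → ℝ) : ℝ :=
  1 / 2 * ((K⁻¹ *ᵥ (M *ᵥ (u + yc)) - yd) ⬝ᵥ (M *ᵥ (K⁻¹ *ᵥ (M *ᵥ (u + yc)) - yd)))
    + α / 4 * (u ⬝ᵥ (M *ᵥ u))

theorem Matrix.IsSymm.dotProduct_mulVec_comm {n R : Type*} [Fintype n] [CommSemiring R]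
    {A : Matrix n n R} (hA : A.IsSymm) (x y : n → R) :
    x ⬝ᵥ (A *ᵥ y) = (A *ᵥ x) ⬝ᵥ y := by
  rw [dotProduct_mulVec, ← mulVec_transpose, hA.eq]

/-- The quadratic form `d ↦ (1/2)⟨d, Σ_f d⟩`, written as a sum of two squared norms. -/
noncomputable def quadf {n : ℕ} (α : ℝ) (M K : Matrix (Fin n) (Fin n) ℝ) (d : Fin n → ℝ) : ℝ :=
  1 / 2 * ((K⁻¹ *ᵥ (M *ᵥ d)) ⬝ᵥ (M *ᵥ (K⁻¹ *ᵥ (M *ᵥ d)))) + α / 4 * (d ⬝ᵥ (M *ᵥ d))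

theorem quadf_smul {n : ℕ} (α t : ℝ) (M K : Matrix (Fin n) (Fin n) ℝ) (d : Fin n → ℝ) :
    quadf α M K (t • d) = t ^ 2 * quadf α M K d := by
  simp only [quadf, mulVec_smul, dotProduct_smul, smul_dotProduct, smul_eq_mul]
  ring

theorem quadf_pos {n : ℕ} {α : ℝ} (hα : 0 < α) {M : Matrix (Fin n) (Fin n) ℝ}
    (K : Matrix (Fin n) (Fin n) ℝ) (hM : M.PosDef) {d : Fin n → ℝ} (hd : d ≠ 0) :
    0 < quadf α M K d := by
  have h₁ : 0 ≤ (K⁻¹ *ᵥ (M *ᵥ d)) ⬝ᵥ (M *ᵥ (K⁻¹ *ᵥ (M *ᵥ d))) := by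
    simpa using hM.posSemidef.dotProduct_mulVec_nonneg (K⁻¹ *ᵥ (M *ᵥ d))
  have h₂ : 0 < d ⬝ᵥ (M *ᵥ d) := by simpa using hM.dotProduct_mulVec_pos hd
  unfold quadf
  positivity

theorem quadf_nonneg {n : ℕ} {α : ℝ} (hα : 0 < α) {M : Matrix (Fin n) (Fin n) ℝ}
    (K : Matrix (Fin n) (Fin n) ℝ) (hM : M.PosDef) (d : Fin n → ℝ) :
    0 ≤ quadf α M K d := by
  rcases eq_or_ne d 0 with rfl | hd
  · simp [quadf]
  · exact (quadf_pos hα K hM hd).le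

/-- The exact second-order expansion of `f`. -/
theorem ffun_add {n : ℕ} (α : ℝ) {M K : Matrix (Fin n) (Fin n) ℝ} (hM : M.IsSymm)
    (hK : K.IsSymm) (yc yd u d : Fin n → ℝ) :
    ffun α M K yc yd (u + d) =
      ffun α M K yc yd u + gradf α M K yc yd u ⬝ᵥ d + quadf α M K d := by
  have hKi : (K⁻¹).IsSymm := by rw [IsSymm, transpose_nonsing_inv, hK.eq]
  set r := K⁻¹ *ᵥ (M *ᵥ (u + yc)) - yd with hr
  set e := K⁻¹ *ᵥ (M *ᵥ d) with he
  have hgrad : gradf α M K yc yd u = (α / 2) • (M *ᵥ u) + M *ᵥ (K⁻¹ *ᵥ (M *ᵥ r)) := by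
    simp only [gradf, Sigf, hr, add_mulVec, smul_mulVec, mulVec_add, mulVec_sub,
      ← mulVec_mulVec]
    abel
  have hcross : (M *ᵥ (K⁻¹ *ᵥ (M *ᵥ r))) ⬝ᵥ d = r ⬝ᵥ (M *ᵥ e) := by
    rw [hM.dotProduct_mulVec_comm r, he, hKi.dotProduct_mulVec_comm, hM.dotProduct_mulVec_comm]
  have hcomm : e ⬝ᵥ (M *ᵥ r) = r ⬝ᵥ (M *ᵥ e) := by
    rw [hM.dotProduct_mulVec_comm r, dotProduct_comm]
  have hcomm' : d ⬝ᵥ (M *ᵥ u) = (M *ᵥ u) ⬝ᵥ d := dotProduct_comm _ _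
  have hshift : K⁻¹ *ᵥ (M *ᵥ (u + d + yc)) - yd = r + e := by
    simp only [hr, he, mulVec_add]
    abel
  rw [hgrad, ffun, ffun, quadf, hshift, ← hr, ← he]
  simp only [mulVec_add, add_dotProduct, dotProduct_add, smul_dotProduct, smul_eq_mul, hcross,
    hcomm, hcomm', hM.dotProduct_mulVec_comm u d]
  ring

theorem gfun_segment_le {n : ℕ} {α β : ℝ} (hα : 0 < α) (hβ : 0 < β) {w : Fin n → ℝ}
    (hw : ∀ i, 0 < w i) (z v : Fin n → ℝ) {t : ℝ} (ht₀ : 0 ≤ t) (ht₁ : t ≤ 1) :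
    gfun α β w (z + t • (v - z)) ≤ (1 - t) * gfun α β w z + t * gfun α β w v := by
  have hsq : ∑ i, w i * (z + t • (v - z)) i ^ 2 ≤
      (1 - t) * ∑ i, w i * z i ^ 2 + t * ∑ i, w i * v i ^ 2 := by
    rw [Finset.mul_sum, Finset.mul_sum, ← Finset.sum_add_distrib]
    refine Finset.sum_le_sum fun i _ => ?_
    simp only [Pi.add_apply, Pi.smul_apply, Pi.sub_apply, smul_eq_mul]
    have := mul_nonneg (mul_nonneg (hw i).le (mul_nonneg ht₀ (sub_nonneg.2 ht₁)))
      (sq_nonneg (v i - z i))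
    linarith
  have habs : ∑ i, w i * |(z + t • (v - z)) i| ≤
      (1 - t) * ∑ i, w i * |z i| + t * ∑ i, w i * |v i| := by
    rw [Finset.mul_sum, Finset.mul_sum, ← Finset.sum_add_distrib]
    refine Finset.sum_le_sum fun i _ => ?_
    have h : |(z + t • (v - z)) i| ≤ (1 - t) * |z i| + t * |v i| :=
      calc |(z + t • (v - z)) i| = |(1 - t) * z i + t * v i| := by
            simp only [Pi.add_apply, Pi.smul_apply, Pi.sub_apply, smul_eq_mul]
            ring_nf
        _ ≤ |(1 - t) * z i| + |t * v i| := abs_add_le _ _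
        _ = (1 - t) * |z i| + t * |v i| := by
            rw [abs_mul, abs_mul, abs_of_nonneg ht₀, abs_of_nonneg (sub_nonneg.2 ht₁)]
    linarith [mul_le_mul_of_nonneg_left h (hw i).le]
  unfold gfun
  linarith [mul_le_mul_of_nonneg_left hsq (by positivity : 0 ≤ α / 4),
    mul_le_mul_of_nonneg_left habs hβ.le]

/-- First-order necessary condition: `-∇f` is a subgradient of `g` at a minimizer of `f + g`. -/
theorem isSubgrad_neg_gradf_of_minimizer {n : ℕ} {α β a b : ℝ} (hα : 0 < α) (hβ : 0 < β)
    {M K : Matrix (Fin n) (Fin n) ℝ} (hM : M.IsSymm) (hK : K.IsSymm)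
    {w : Fin n → ℝ} (hw : ∀ i, 0 < w i) {yc yd z : Fin n → ℝ} (hz : ∀ i, z i ∈ Set.Icc a b)
    (hmin : ∀ v : Fin n → ℝ, (∀ i, v i ∈ Set.Icc a b) →
      ffun α M K yc yd z + gfun α β w z ≤ ffun α M K yc yd v + gfun α β w v) :
    IsSubgrad α β a b w z (-gradf α M K yc yd z) := by
  intro v hv
  set c := gfun α β w z - gradf α M K yc yd z ⬝ᵥ (v - z) - gfun α β w v with hc
  have key : ∀ t : ℝ, 0 < t → t ≤ 1 → c ≤ t * quadf α M K (v - z) := by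
    intro t ht₀ ht₁
    have hbox : ∀ i, (z + t • (v - z)) i ∈ Set.Icc a b := fun i =>
      (convex_Icc a b).add_smul_sub_mem (hz i) (hv i) ⟨ht₀.le, ht₁⟩
    have h₁ := hmin _ hbox
    have h₂ := gfun_segment_le hα hβ hw z v ht₀.le ht₁
    rw [ffun_add α hM hK, quadf_smul, dotProduct_smul, smul_eq_mul] at h₁
    refine le_of_mul_le_mul_left ?_ ht₀
    rw [hc]
    linarith
  have hlim : Filter.Tendsto (fun t : ℝ => t * quadf α M K (v - z))
      (nhdsWithin 0 (Set.Ioi 0)) (nhds 0) := by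
    have h : Continuous fun t : ℝ => t * quadf α M K (v - z) := by fun_prop
    simpa using (h.tendsto 0).mono_left nhdsWithin_le_nhds
  have hc₀ : c ≤ 0 := by
    refine ge_of_tendsto hlim ?_
    filter_upwards [Ioc_mem_nhdsGT (zero_lt_one' ℝ)] with t ht using key t ht.1 ht.2
  rw [neg_dotProduct]
  linarith

/-- The objective grows at least quadratically away from a first-order stationary point. -/
theorem add_quadf_le_of_isSubgrad {n : ℕ} {α β a b : ℝ}
    {M K : Matrix (Fin n) (Fin n) ℝ} (hM : M.IsSymm) (hK : K.IsSymm)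
    {w yc yd z : Fin n → ℝ} (hsub : IsSubgrad α β a b w z (-gradf α M K yc yd z))
    {v : Fin n → ℝ} (hv : ∀ i, v i ∈ Set.Icc a b) :
    ffun α M K yc yd z + gfun α β w z + quadf α M K (v - z) ≤
      ffun α M K yc yd v + gfun α β w v := by
  have h₁ := ffun_add α hM hK yc yd z (v - z)
  have h₂ := hsub v hv
  rw [add_sub_cancel] at h₁
  rw [neg_dotProduct] at h₂
  linarith

/-- a feasible pair `(u*, z*)` (with `z* ∈ [a,b]ⁿ`, `u* = z*`) minimizes
`f(u) + g(z)` over all feasible pairs iff there exists `λ*` with `−Mλ* = ∇f(u*)` and `Mλ*`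
a subgradient of `g` at `z*`; moreover the minimizing pair is unique. -/
theorem stmt_13 (n : ℕ) (hn : 1 ≤ n) (α β a b : ℝ)
    (hα : 0 < α) (hβ : 0 < β) (ha : a < 0) (hb : 0 < b)
    (M K : Matrix (Fin n) (Fin n) ℝ) (hM : M.PosDef) (hK : K.PosDef)
    (w : Fin n → ℝ) (hw : ∀ i, 0 < w i) (yc yd : Fin n → ℝ)
    (ustar zstar : Fin n → ℝ)
    (hbox : ∀ i, zstar i ∈ Set.Icc a b) (huz : ustar = zstar) :
    ((∀ uu zz : Fin n → ℝ, (∀ i, zz i ∈ Set.Icc a b) → uu = zz →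
        ffun α M K yc yd ustar + gfun α β w zstar ≤ ffun α M K yc yd uu + gfun α β w zz) ↔
      ∃ lstar : Fin n → ℝ,
        -(M *ᵥ lstar) = gradf α M K yc yd ustar ∧
        IsSubgrad α β a b w zstar (M *ᵥ lstar)) ∧
    (∀ u₁ z₁ u₂ z₂ : Fin n → ℝ,
      (∀ i, z₁ i ∈ Set.Icc a b) → u₁ = z₁ →
      (∀ uu zz : Fin n → ℝ, (∀ i, zz i ∈ Set.Icc a b) → uu = zz →
        ffun α M K yc yd u₁ + gfun α β w z₁ ≤ ffun α M K yc yd uu + gfun α β w zz) →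
      (∀ i, z₂ i ∈ Set.Icc a b) → u₂ = z₂ →
      (∀ uu zz : Fin n → ℝ, (∀ i, zz i ∈ Set.Icc a b) → uu = zz →
        ffun α M K yc yd u₂ + gfun α β w z₂ ≤ ffun α M K yc yd uu + gfun α β w zz) →
      u₁ = u₂ ∧ z₁ = z₂) := by
  have hMs : M.IsSymm := by simpa using hM.isHermitian
  have hKs : K.IsSymm := by simpa using hK.isHermitian
  refine ⟨⟨fun hmin => ?_, ?_⟩, ?_⟩
  · subst huz
    have hdet : IsUnit M.det := (isUnit_iff_isUnit_det M).1 hM.isUnit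
    have hl : M *ᵥ (M⁻¹ *ᵥ (-gradf α M K yc yd ustar)) = -gradf α M K yc yd ustar := by
      rw [mulVec_mulVec, mul_nonsing_inv M hdet, one_mulVec]
    refine ⟨M⁻¹ *ᵥ (-gradf α M K yc yd ustar), by rw [hl, neg_neg], ?_⟩
    rw [hl]
    exact isSubgrad_neg_gradf_of_minimizer hα hβ hMs hKs hw hbox fun v hv => hmin v v hv rfl
  · rintro ⟨l, hl, hsub⟩ uu zz hzz rfl
    subst huz
    rw [← neg_neg (M *ᵥ l), hl] at hsub
    linarith [add_quadf_le_of_isSubgrad hMs hKs hsub hzz, quadf_nonneg hα K hM (uu - ustar)]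
  · rintro u₁ _ u₂ _ h₁ rfl hmin₁ h₂ rfl hmin₂
    have hsub := isSubgrad_neg_gradf_of_minimizer hα hβ hMs hKs hw h₁
      fun v hv => hmin₁ v v hv rfl
    have heq : u₁ = u₂ := by
      by_contra hne
      have hpos := quadf_pos hα K hM (sub_ne_zero.2 (Ne.symm hne))
      linarith [add_quadf_le_of_isSubgrad hMs hKs hsub h₂, hmin₂ u₁ u₁ h₁ rfl]
    exact ⟨heq, heq⟩
end
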